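/- (Deterministic core of Theorem 1 of the paper: total compensation without information gap, on the confidence event.) Let d ≥ 1, λ ≥ 1, T ≥ 1, and let α_1, …, α_T be a nonnegative nondecreasing sequence. For each round t, let 𝒜_t be a finite nonempty arm set with features x_a ∈ ℝ^d, ‖x_a‖₂ ≤ 1, and suppose the pulled arm a_t maximizes a ↦ r̂_t(a) + α_t·‖x_a‖_{A_t⁻¹} over 𝒜_t, where r̂_t : 𝒜_t → ℝ is arbitrary, A_1 = λI_d, and A_{t+1} = A_t + x_{a_t} x_{a_t}ᵀ. Then the total compensation C(T) = Σ_{t=1}^{T} (max_{a ∈ 𝒜_t} r̂_t(a) − r̂_t(a_t)) satisfies C(T) ≤ Σ_{t=1}^{T} α_t·‖x_{a_t}‖_{A_t⁻¹} ≤ α_T·√(2·T·d·log(1 + T/(λd))). -/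

import Mathlib

open Matrix

namespace Matrix

variable {n : Type*} [Fintype n]

/-- The **matrix determinant lemma** for a symmetric rank-one update. -/
theorem det_add_vecMulVec_self [DecidableEq n] {A : Matrix n n ℝ} (hA : IsUnit A.det) (v : n → ℝ) :
    (A + vecMulVec v v).det = A.det * (1 + v ⬝ᵥ A⁻¹ *ᵥ v) := by
  rw [vecMulVec_eq Unit, det_add_replicateCol_mul_replicateRow hA, det_unique (n := Unit),
    Matrix.mul_assoc]
  congr 2

theorem dotProduct_vecMulVec_self_mulVec (v y : n → ℝ) :
    y ⬝ᵥ vecMulVec v v *ᵥ y = (v ⬝ᵥ y) ^ 2 := by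
  rw [vecMulVec_mulVec, dotProduct_comm v y]
  simp [dotProduct_smul, sq]

theorem PosDef.add_vecMulVec_self {A : Matrix n n ℝ} (hA : A.PosDef) (v : n → ℝ) :
    (A + vecMulVec v v).PosDef := by
  simpa using hA.add_posSemidef (posSemidef_vecMulVec_self_star v)

theorem PosDef.dotProduct_inv_mulVec_nonneg [DecidableEq n] {A : Matrix n n ℝ} (hA : A.PosDef)
    (v : n → ℝ) :
    0 ≤ v ⬝ᵥ A⁻¹ *ᵥ v := by
  simpa using hA.inv.posSemidef.dotProduct_mulVec_nonneg v

/-- If `A` dominates the identity, then `vᵀ A⁻¹ v ≤ vᵀ v`. -/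
theorem PosDef.dotProduct_inv_mulVec_le [DecidableEq n] {A : Matrix n n ℝ} (hA : A.PosDef)
    (h : ∀ y, y ⬝ᵥ y ≤ y ⬝ᵥ A *ᵥ y) (v : n → ℝ) :
    v ⬝ᵥ A⁻¹ *ᵥ v ≤ v ⬝ᵥ v := by
  have hy := h (A⁻¹ *ᵥ v)
  rw [mulVec_mulVec, mul_nonsing_inv _ ((isUnit_iff_isUnit_det _).1 hA.isUnit), one_mulVec,
    dotProduct_comm _ v] at hy
  have hsq : 0 ≤ (v - A⁻¹ *ᵥ v) ⬝ᵥ (v - A⁻¹ *ᵥ v) := by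
    simpa using dotProduct_star_self_nonneg (v - A⁻¹ *ᵥ v)
  rw [sub_dotProduct, dotProduct_sub, dotProduct_sub, dotProduct_comm (A⁻¹ *ᵥ v) v] at hsq
  linarith

/-- A form of the AM-GM inequality between determinant and trace. -/
theorem PosDef.log_det_le [DecidableEq n] {A : Matrix n n ℝ} (hA : A.PosDef) {m : ℝ} (hm : 0 < m)
    (htr : A.trace ≤ Fintype.card n * m) :
    Real.log A.det ≤ Fintype.card n * Real.log m := by
  have hdet : A.det = ∏ i, hA.1.eigenvalues i := by simpa using hA.1.det_eq_prod_eigenvalues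
  have htrace : A.trace = ∑ i, hA.1.eigenvalues i := by
    simpa using hA.1.trace_eq_sum_eigenvalues
  rw [hdet, Real.log_prod fun i _ => (hA.eigenvalues_pos i).ne']
  calc ∑ i, Real.log (hA.1.eigenvalues i)
      ≤ ∑ i, (Real.log m + hA.1.eigenvalues i / m - 1) := by
        refine Finset.sum_le_sum fun i _ => ?_
        have := Real.log_le_sub_one_of_pos (div_pos (hA.eigenvalues_pos i) hm)
        rw [Real.log_div (hA.eigenvalues_pos i).ne' hm.ne'] at this
        linarith
    _ = Fintype.card n * Real.log m + A.trace / m - Fintype.card n := by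
        rw [htrace, Finset.sum_sub_distrib, Finset.sum_add_distrib, ← Finset.sum_div]
        simp
    _ ≤ Fintype.card n * Real.log m := by
        have := (div_le_iff₀ hm).2 htr
        linarith

end Matrix

theorem Real.le_two_mul_log_one_add {u : ℝ} (h0 : 0 ≤ u) (h1 : u ≤ 1) :
    u ≤ 2 * Real.log (1 + u) := by
  have h := Real.le_log_one_add_of_nonneg h0
  have : u / 2 ≤ 2 * u / (u + 2) := by
    rw [div_le_div_iff₀ two_pos (by linarith)]
    nlinarith
  linarith

/-- The **elliptical potential lemma**. -/
theorem sum_dotProduct_inv_mulVec_le {n : Type*} [Fintype n] [DecidableEq n] [Nonempty n]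
    {lam : ℝ} (hlam : 1 ≤ lam) {T : ℕ} (v : ℕ → n → ℝ)
    (hv : ∀ t, 1 ≤ t → t ≤ T → v t ⬝ᵥ v t ≤ 1) {A : ℕ → Matrix n n ℝ}
    (hA1 : A 1 = lam • (1 : Matrix n n ℝ))
    (hAs : ∀ t, 1 ≤ t → t ≤ T → A (t + 1) = A t + vecMulVec (v t) (v t)) :
    (∀ t ∈ Finset.Icc 1 T, 0 ≤ v t ⬝ᵥ (A t)⁻¹ *ᵥ v t) ∧
      ∑ t ∈ Finset.Icc 1 T, v t ⬝ᵥ (A t)⁻¹ *ᵥ v t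
        ≤ 2 * (Fintype.card n * Real.log (1 + T / (lam * Fintype.card n))) := by
  have hlam0 : 0 < lam := by linarith
  have hc : (0 : ℝ) < Fintype.card n := by exact_mod_cast Fintype.card_pos
  have key : ∀ k ≤ T, (A (k + 1)).PosDef ∧ (∀ y, y ⬝ᵥ y ≤ y ⬝ᵥ A (k + 1) *ᵥ y) ∧
      (A (k + 1)).trace ≤ Fintype.card n * lam + k ∧
      Real.log (A (k + 1)).det = Fintype.card n * Real.log lam +
        ∑ t ∈ Finset.Icc 1 k, Real.log (1 + v t ⬝ᵥ (A t)⁻¹ *ᵥ v t) := by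
    intro k
    induction k with
    | zero =>
      intro _
      rw [zero_add, hA1]
      refine ⟨PosDef.one.smul hlam0, fun y => ?_, ?_, ?_⟩
      · have hy : 0 ≤ y ⬝ᵥ y := by simpa using dotProduct_star_self_nonneg y
        rw [smul_mulVec, one_mulVec, dotProduct_smul, smul_eq_mul]
        nlinarith
      · simp [mul_comm]
      · simp
    | succ k ih =>
      intro hk
      obtain ⟨hpd, hdom, htr, hlog⟩ := ih (by omega)
      rw [hAs (k + 1) (by omega) hk]
      refine ⟨hpd.add_vecMulVec_self _, fun y => ?_, ?_, ?_⟩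
      · rw [add_mulVec, dotProduct_add, dotProduct_vecMulVec_self_mulVec]
        have := hdom y
        nlinarith [sq_nonneg (v (k + 1) ⬝ᵥ y)]
      · rw [trace_add, trace_vecMulVec]
        have := hv (k + 1) (by omega) hk
        push_cast
        linarith
      · rw [det_add_vecMulVec_self hpd.det_pos.ne'.isUnit,
          Real.log_mul hpd.det_pos.ne'
            (by linarith [hpd.dotProduct_inv_mulVec_nonneg (v (k + 1))] : (0 : ℝ) < _).ne',
          hlog, Finset.sum_Icc_succ_top (by omega), add_assoc]
  have hpred : ∀ t ∈ Finset.Icc 1 T, (A t).PosDef ∧ ∀ y, y ⬝ᵥ y ≤ y ⬝ᵥ A t *ᵥ y := by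
    intro t ht
    obtain ⟨h1, h2⟩ := Finset.mem_Icc.1 ht
    obtain ⟨k, rfl⟩ := Nat.exists_eq_add_of_le' h1
    obtain ⟨hpd, hdom, -⟩ := key k (by omega)
    exact ⟨hpd, hdom⟩
  refine ⟨fun t ht => (hpred t ht).1.dotProduct_inv_mulVec_nonneg _, ?_⟩
  obtain ⟨hpd, -, htr, hlog⟩ := key T le_rfl
  have hm : 0 < lam + T / Fintype.card n := by positivity
  have hdet := hpd.log_det_le hm (by rw [mul_add, mul_div_cancel₀ _ hc.ne']; exact htr)
  have hfac : lam + T / Fintype.card n = lam * (1 + T / (lam * Fintype.card n)) := by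
    field_simp
  rw [hfac, Real.log_mul hlam0.ne' (by positivity), hlog] at hdet
  calc ∑ t ∈ Finset.Icc 1 T, v t ⬝ᵥ (A t)⁻¹ *ᵥ v t
      ≤ ∑ t ∈ Finset.Icc 1 T, 2 * Real.log (1 + v t ⬝ᵥ (A t)⁻¹ *ᵥ v t) := by
        refine Finset.sum_le_sum fun t ht => ?_
        obtain ⟨hpdt, hdom⟩ := hpred t ht
        obtain ⟨h1, h2⟩ := Finset.mem_Icc.1 ht
        exact Real.le_two_mul_log_one_add (hpdt.dotProduct_inv_mulVec_nonneg _)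
          ((hpdt.dotProduct_inv_mulVec_le hdom _).trans (hv t h1 h2))
    _ ≤ 2 * (Fintype.card n * Real.log (1 + T / (lam * Fintype.card n))) := by
        rw [← Finset.mul_sum]
        linarith

/-- deterministic core of Theorem 1 of the paper (total
compensation without information gap, on the confidence event). Arms at each
round are indexed by a finite nonempty type `ι` with round-dependent features
`x t a`; the pulled arm `arm t` maximizes `r̂_t(a) + α_t ‖x_a‖_{A_t⁻¹}`. Then
`C(T) = Σ_t (max_a r̂_t(a) - r̂_t(a_t)) ≤ Σ_t α_t ‖x_{a_t}‖_{A_t⁻¹}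
  ≤ α_T √(2 T d log(1 + T/(λ d)))`. -/
theorem total_compensation_bound_no_gap
    (d : ℕ) (hd : 1 ≤ d) (lam : ℝ) (hlam : 1 ≤ lam) (T : ℕ) (hT : 1 ≤ T)
    (α : ℕ → ℝ)
    (hα0 : ∀ t, 1 ≤ t → t ≤ T → 0 ≤ α t)
    (hαmono : ∀ s t, 1 ≤ s → s ≤ t → t ≤ T → α s ≤ α t)
    {ι : Type*} [Fintype ι] [Nonempty ι]
    (x : ℕ → ι → Fin d → ℝ)
    (hnorm : ∀ t, 1 ≤ t → t ≤ T → ∀ a, Real.sqrt (x t a ⬝ᵥ x t a) ≤ 1)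
    (arm : ℕ → ι)
    (A : ℕ → Matrix (Fin d) (Fin d) ℝ)
    (hA1 : A 1 = lam • (1 : Matrix (Fin d) (Fin d) ℝ))
    (hAs : ∀ t, 1 ≤ t → t ≤ T →
      A (t + 1) = A t + Matrix.vecMulVec (x t (arm t)) (x t (arm t)))
    (rhat : ℕ → ι → ℝ)
    (hpull : ∀ t, 1 ≤ t → t ≤ T → ∀ a,
      rhat t a + α t * Real.sqrt (x t a ⬝ᵥ ((A t)⁻¹).mulVec (x t a))
        ≤ rhat t (arm t)
          + α t * Real.sqrt (x t (arm t) ⬝ᵥ ((A t)⁻¹).mulVec (x t (arm t)))) :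
    (∑ t ∈ Finset.Icc 1 T,
        (Finset.univ.sup' Finset.univ_nonempty (rhat t) - rhat t (arm t))
      ≤ ∑ t ∈ Finset.Icc 1 T,
          α t * Real.sqrt (x t (arm t) ⬝ᵥ ((A t)⁻¹).mulVec (x t (arm t)))) ∧
    (∑ t ∈ Finset.Icc 1 T,
        α t * Real.sqrt (x t (arm t) ⬝ᵥ ((A t)⁻¹).mulVec (x t (arm t)))
      ≤ α T * Real.sqrt (2 * T * d * Real.log (1 + (T : ℝ) / (lam * d)))) := by
  constructor
  · refine Finset.sum_le_sum fun t ht => ?_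
    obtain ⟨h1, h2⟩ := Finset.mem_Icc.1 ht
    rw [sub_le_iff_le_add]
    refine Finset.sup'_le _ _ fun a _ => ?_
    have hnonneg := mul_nonneg (hα0 t h1 h2)
      (Real.sqrt_nonneg (x t a ⬝ᵥ ((A t)⁻¹).mulVec (x t a)))
    linarith [hpull t h1 h2 a]
  · have : Nonempty (Fin d) := ⟨⟨0, hd⟩⟩
    obtain ⟨hnonneg, hsum⟩ := sum_dotProduct_inv_mulVec_le hlam (fun t => x t (arm t))
      (fun t h1 h2 => by simpa using hnorm t h1 h2 (arm t)) hA1 hAs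
    rw [Fintype.card_fin] at hsum
    calc ∑ t ∈ Finset.Icc 1 T,
          α t * Real.sqrt (x t (arm t) ⬝ᵥ ((A t)⁻¹).mulVec (x t (arm t)))
        ≤ ∑ t ∈ Finset.Icc 1 T,
          α T * Real.sqrt (x t (arm t) ⬝ᵥ ((A t)⁻¹).mulVec (x t (arm t))) := by
          refine Finset.sum_le_sum fun t ht => ?_
          obtain ⟨h1, h2⟩ := Finset.mem_Icc.1 ht
          exact mul_le_mul_of_nonneg_right (hαmono t T h1 h2 le_rfl) (Real.sqrt_nonneg _)
      _ ≤ α T * Real.sqrt (2 * T * d * Real.log (1 + (T : ℝ) / (lam * d))) := by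
          rw [← Finset.mul_sum]
          refine mul_le_mul_of_nonneg_left (Real.le_sqrt_of_sq_le ?_) (hα0 T hT le_rfl)
          refine sq_sum_le_card_mul_sum_sq.trans ?_
          rw [Finset.sum_congr rfl fun t ht => Real.sq_sqrt (hnonneg t ht), Nat.card_Icc,
            Nat.add_sub_cancel]
          refine (mul_le_mul_of_nonneg_left hsum T.cast_nonneg).trans_eq ?_
          ring
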